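/- arXiv:1610.05597 — 2 statements merged into one kernel-verified Lean document; each statement's English description precedes it below -/
import Mathlib

section
/- Let V be a vector space over ℚ, B : V → V → ℚ an alternating bilinear form, δ ∈ V, and let T : V → V be the symplectic transvection T(x) = x - B(x,δ)·δ. Let H ⊆ V be a linear subspace and suppose there is a nonzero integer m such that T^m(H) ⊆ H (where T^m denotes the m-th power of T in the group of linear automorphisms of V). Then T(H) ⊆ H and T⁻¹(H) ⊆ H; in particular H is invariant under the cyclic group generated by T. -/
/-- Integer powers of a transvection `x ↦ x - B x δ • δ` with `B δ δ = 0`. -/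
theorem transvection_zpow_apply {R V : Type*} [CommRing R] [AddCommGroup V] [Module R V]
    (B : LinearMap.BilinForm R V) {δ : V} (hδ : B δ δ = 0) {T : V ≃ₗ[R] V}
    (hT : ∀ x, T x = x - B x δ • δ) (n : ℤ) (x : V) :
    (T ^ n) x = x - ((n : R) * B x δ) • δ := by
  have hTinv (x : V) : T⁻¹ x = x + B x δ • δ := by
    apply T.injective
    rw [← LinearEquiv.mul_apply, mul_inv_cancel, LinearEquiv.coe_one, id_eq, hT]
    simp [hδ]
  induction n generalizing x with
  | zero => simp
  | succ k ih =>
    rw [zpow_add_one, LinearEquiv.mul_apply, ih, hT]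
    simp only [map_sub, map_smul, LinearMap.sub_apply, LinearMap.smul_apply, hδ, smul_zero,
      sub_zero]
    push_cast
    module
  | pred k ih =>
    rw [zpow_sub_one, LinearEquiv.mul_apply, ih, hTinv]
    simp only [map_add, map_smul, LinearMap.add_apply, LinearMap.smul_apply, hδ, smul_zero,
      add_zero]
    push_cast
    module

/-- If a linear subspace `H` is carried into itself by a nonzero power `T^m`
(in the group of linear automorphisms of `V`) of a symplectic transvection
`T x = x - B x δ • δ`, then `H` is stable under `T`, under `T⁻¹`, and under
every integer power of `T` (the cyclic group generated by `T`). -/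
theorem symplectic_transvection_power_invariant_subspace
    (V : Type*) [AddCommGroup V] [Module ℚ V]
    (B : LinearMap.BilinForm ℚ V) (hB : B.IsAlt)
    (δ : V) (T : V ≃ₗ[ℚ] V)
    (hT : ∀ x, T x = x - B x δ • δ)
    (H : Submodule ℚ V) (m : ℤ) (hm : m ≠ 0)
    (hH : ∀ x ∈ H, (T ^ m) x ∈ H) :
    (∀ x ∈ H, T x ∈ H) ∧ (∀ x ∈ H, T⁻¹ x ∈ H) ∧
      ∀ (n : ℤ), ∀ x ∈ H, (T ^ n) x ∈ H := by
  have hpow := transvection_zpow_apply B (hB δ) hT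
  have hmem (x : V) (hx : x ∈ H) : B x δ • δ ∈ H := by
    have h := H.sub_mem hx (hH x hx)
    rw [hpow, sub_sub_cancel, mul_smul] at h
    exact (H.smul_mem_iff (Int.cast_ne_zero.mpr hm)).mp h
  have hstable (n : ℤ) (x : V) (hx : x ∈ H) : (T ^ n) x ∈ H := by
    rw [hpow, mul_smul]
    exact H.sub_mem hx (H.smul_mem _ (hmem x hx))
  exact ⟨by simpa using hstable 1, by simpa only [zpow_neg_one] using hstable (-1), hstable⟩
end

section
/- Let V be a vector space over ℚ with an alternating bilinear form B : V → V → ℚ. Let G be a group acting on V by linear automorphisms, and let S ⊆ G be a generating set of G such that every s ∈ S acts on V as a symplectic transvection, i.e. there is δ_s ∈ V with s·x = x - B(x,δ_s)·δ_s for all x ∈ V. Let Γ ≤ G be a subgroup of finite index and let H ⊆ V be a linear subspace with γ·H ⊆ H for all γ ∈ Γ. Then g·H ⊆ H for all g ∈ G; that is, H is invariant under the whole group G. -/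
/-- Powers of a transvection: `s ^ n` acts as `x ↦ x - n • B x δ • δ`. -/
theorem transvection_pow_smul {V : Type*} [AddCommGroup V] [Module ℚ V]
    {B : LinearMap.BilinForm ℚ V} (hB : B.IsAlt) {G : Type*} [Group G] [DistribMulAction G V]
    {s : G} {δ : V} (hs : ∀ x : V, s • x = x - B x δ • δ) (n : ℕ) (x : V) :
    s ^ n • x = x - ((n : ℚ) * B x δ) • δ := by
  induction n generalizing x with
  | zero => simp
  | succ k ih =>
    rw [pow_succ, mul_smul, ih, hs]
    have hδ : B δ δ = 0 := hB δ
    simp only [map_sub, map_smul, LinearMap.sub_apply, LinearMap.smul_apply, hδ, smul_zero,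
      sub_zero, Nat.cast_succ]
    module

/-- A subspace preserved by a positive power of a transvection is preserved by the transvection
and by its inverse. -/
theorem transvection_smul_mem_iff {V : Type*} [AddCommGroup V] [Module ℚ V]
    {B : LinearMap.BilinForm ℚ V} (hB : B.IsAlt) {G : Type*} [Group G] [DistribMulAction G V]
    {s : G} {δ : V} (hs : ∀ x : V, s • x = x - B x δ • δ) {n : ℕ} (hn : n ≠ 0)
    {H : Submodule ℚ V} (hH : ∀ x ∈ H, s ^ n • x ∈ H) (x : V) : s • x ∈ H ↔ x ∈ H := by
  have key : ∀ y ∈ H, B y δ • δ ∈ H := by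
    intro y hy
    have h := H.smul_mem (n : ℚ)⁻¹ (H.sub_mem hy (hH y hy))
    have hn' : (n : ℚ) ≠ 0 := Nat.cast_ne_zero.mpr hn
    rwa [transvection_pow_smul hB hs, sub_sub_cancel, smul_smul, inv_mul_cancel_left₀ hn'] at h
  refine ⟨fun h => ?_, fun h => hs x ▸ H.sub_mem h (key x h)⟩
  have hδ : B δ δ = 0 := hB δ
  have hB' : B (s • x) δ = B x δ := by simp [hs, hδ]
  have h' := H.add_mem h (key _ h)
  rwa [hB', hs, sub_add_cancel] at h'


/-- Let `G` act linearly on a `ℚ`-vector space `V` with alternating bilinear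
form `B`, with `G` generated by a set `S` of elements each acting as a
symplectic transvection. If a linear subspace `H` is invariant under a
finite-index subgroup `Γ` of `G`, then `H` is invariant under all of `G`. -/
theorem transvection_group_finite_index_invariant_subspace
    (V : Type*) [AddCommGroup V] [Module ℚ V]
    (B : LinearMap.BilinForm ℚ V) (hB : B.IsAlt)
    (G : Type*) [Group G] [DistribMulAction G V] [SMulCommClass G ℚ V]
    (S : Set G) (hS : Subgroup.closure S = ⊤)
    (hSt : ∀ s ∈ S, ∃ δ : V, ∀ x : V, s • x = x - B x δ • δ)
    (Γ : Subgroup G) (hΓ : Γ.FiniteIndex)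
    (H : Submodule ℚ V) (hH : ∀ γ ∈ Γ, ∀ x ∈ H, γ • x ∈ H) :
    ∀ g : G, ∀ x ∈ H, g • x ∈ H := by
  suffices h : ∀ g : G, ∀ x : V, g • x ∈ H ↔ x ∈ H from fun g x hx => (h g x).mpr hx
  intro g
  have hg : g ∈ Subgroup.closure S := hS ▸ Subgroup.mem_top g
  induction hg using Subgroup.closure_induction with
  | mem s hs =>
    obtain ⟨δ, hδ⟩ := hSt s hs
    obtain ⟨n, hn, -, hmem⟩ := Subgroup.exists_pow_mem_of_index_ne_zero hΓ.index_ne_zero s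
    exact transvection_smul_mem_iff hB hδ hn.ne' (hH _ hmem)
  | one => simp
  | mul a b _ _ iha ihb => exact fun x => by rw [mul_smul, iha, ihb]
  | inv a _ iha => exact fun x => by rw [← iha, smul_inv_smul]
end
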